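/- Let G be a simple graph on n vertices whose complement has maximum degree at most 2 (i.e., every vertex of G has degree at least n − 3), and suppose |E(G)| ≥ 3n − 6 and n ≥ 6 and δ(G) ≥ 4. Then G has a spanning subgraph H with minimum degree δ(H) ≥ 4 and exactly 3n − 6 edges. -/

import Mathlib

namespace SimpleGraph

variable {V : Type*} {G H : SimpleGraph V}

theorem ncard_neighborSet (H : SimpleGraph V) (v : V) [Fintype (H.neighborSet v)] :
    (H.neighborSet v).ncard = H.degree v :=
  Set.ncard_eq_toFinset_card' _

theorem exists_between_ncard_edgeSet_eq {m : ℕ} (hHG : H ≤ G) (hH : H.edgeSet.ncard ≤ m)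
    (hG : m ≤ G.edgeSet.ncard) : ∃ K, H ≤ K ∧ K ≤ G ∧ K.edgeSet.ncard = m := by
  obtain ⟨s, hHs, hsG, hs⟩ := Set.exists_subsuperset_card_eq (edgeSet_mono hHG) hH hG
  have hedge : (fromEdgeSet s).edgeSet = s := by
    rw [edgeSet_fromEdgeSet, sdiff_eq_left, Set.disjoint_left]
    exact fun e he => G.not_isDiag_of_mem_edgeSet (hsG he)
  refine ⟨fromEdgeSet s, ?_, ?_, by rwa [hedge]⟩
  · rwa [← edgeSet_subset_edgeSet, hedge]
  · rwa [← edgeSet_subset_edgeSet, hedge]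

variable [Fintype V]

/-- `H` has the least degree sum among the spanning subgraphs of `G` of minimum degree at least
`k`. -/
structure IsMinimumSpanning (G : SimpleGraph V) (k : ℕ) (H : SimpleGraph V) : Prop where
  le : H ≤ G
  le_degree : ∀ v, k ≤ (H.neighborSet v).ncard
  sum_le : ∀ K ≤ G, (∀ v, k ≤ (K.neighborSet v).ncard) →
    ∑ v, (H.neighborSet v).ncard ≤ ∑ v, (K.neighborSet v).ncard

theorem exists_isMinimumSpanning {k : ℕ} (hG : ∀ v, k ≤ (G.neighborSet v).ncard) :
    ∃ H, G.IsMinimumSpanning k H := by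
  obtain ⟨H, ⟨hle, hdeg⟩, hmin⟩ := Set.exists_min_image
    {H : SimpleGraph V | H ≤ G ∧ ∀ v, k ≤ (H.neighborSet v).ncard}
    (fun H => ∑ v, (H.neighborSet v).ncard) (Set.toFinite _) ⟨G, le_rfl, hG⟩
  exact ⟨H, hle, hdeg, fun K hK hKdeg => hmin K ⟨hK, hKdeg⟩⟩

namespace IsMinimumSpanning

variable {k : ℕ} {u v x y : V}

theorem not_ncard_lt {K : SimpleGraph V} (h : G.IsMinimumSpanning k H) (hK : K ≤ G)
    (hKdeg : ∀ v, k ≤ (K.neighborSet v).ncard)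
    (hle : ∀ v, (K.neighborSet v).ncard ≤ (H.neighborSet v).ncard) (u : V) :
    ¬ (K.neighborSet u).ncard < (H.neighborSet u).ncard := fun hlt =>
  (h.sum_le K hK hKdeg).not_gt
    (Finset.sum_lt_sum (fun v _ => hle v) ⟨u, Finset.mem_univ u, hlt⟩)

/-- In a minimum spanning subgraph the vertices of excess degree are independent: an edge between
two of them could be deleted. -/
theorem ncard_eq_of_adj (h : G.IsMinimumSpanning k H) (huv : H.Adj u v)
    (hu : k < (H.neighborSet u).ncard) : (H.neighborSet v).ncard = k := by
  by_contra hv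
  replace hv : k < (H.neighborSet v).ncard := lt_of_le_of_ne (h.le_degree v) (Ne.symm hv)
  set K := H.deleteEdges {s(u, v)} with hKdef
  have hKH : K ≤ H := H.deleteEdges_le _
  have hKu : (K.neighborSet u).ncard + 1 = (H.neighborSet u).ncard := by
    have : K.neighborSet u = H.neighborSet u \ {v} := by
      ext w; simp [hKdef, deleteEdges_adj]; grind
    rw [this]
    exact Set.ncard_sdiff_singleton_add_one huv
  have hKv : (K.neighborSet v).ncard + 1 = (H.neighborSet v).ncard := by
    have : K.neighborSet v = H.neighborSet v \ {u} := by
      ext w; simp [hKdef, deleteEdges_adj]; grind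
    rw [this]
    exact Set.ncard_sdiff_singleton_add_one huv.symm
  have hKw : ∀ w, w ≠ u → w ≠ v → K.neighborSet w = H.neighborSet w := by
    intro w hwu hwv
    ext z; simp [hKdef, deleteEdges_adj]; grind
  refine h.not_ncard_lt (hKH.trans h.le) (fun w => ?_) (fun w => ?_) u (by omega)
  · rcases eq_or_ne w u with rfl | hwu
    · omega
    rcases eq_or_ne w v with rfl | hwv
    · omega
    exact hKw w hwu hwv ▸ h.le_degree w
  · exact Set.ncard_le_ncard fun z hz => hKH hz

/-- In a minimum spanning subgraph the neighbourhood of a vertex of excess degree at least two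
is induced: otherwise two edges `ux`, `uy` could be replaced by the single edge `xy`. -/
theorem adj_of_adj (h : G.IsMinimumSpanning k H) (hux : H.Adj u x) (huy : H.Adj u y)
    (hxy : G.Adj x y) (hu : k + 2 ≤ (H.neighborSet u).ncard) : H.Adj x y := by
  by_contra hHxy
  have hne := hxy.ne
  have hux' := hux.ne
  have huy' := huy.ne
  set K := H.deleteEdges {s(u, x), s(u, y)} ⊔ edge x y with hKdef
  have hadj : ∀ a b, K.Adj a b ↔ (H.Adj a b ∧ s(a, b) ≠ s(u, x) ∧ s(a, b) ≠ s(u, y)) ∨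
      s(a, b) = s(x, y) := by
    intro a b
    simp only [hKdef, sup_adj, deleteEdges_adj, edge_adj, Set.mem_insert_iff,
      Set.mem_singleton_iff, Sym2.eq_iff]
    grind
  have hKG : K ≤ G := by
    intro a b hab
    rcases (hadj a b).1 hab with hab | hab
    · exact h.le hab.1
    · rwa [← mem_edgeSet, hab]
  have hKu : (K.neighborSet u).ncard + 2 = (H.neighborSet u).ncard := by
    have : K.neighborSet u = (H.neighborSet u \ {x}) \ {y} := by
      ext w; simp only [mem_neighborSet, hadj, Sym2.eq_iff, Set.mem_sdiff, Set.mem_singleton_iff]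
      grind
    have h₁ := Set.ncard_sdiff_singleton_add_one (s := H.neighborSet u) hux
    have h₂ := Set.ncard_sdiff_singleton_add_one (s := H.neighborSet u \ {x}) (a := y)
      ⟨huy, hne.symm⟩
    rw [this]
    omega
  have hKx : (K.neighborSet x).ncard = (H.neighborSet x).ncard := by
    have : K.neighborSet x = insert y (H.neighborSet x \ {u}) := by
      ext w; simp only [mem_neighborSet, hadj, Sym2.eq_iff, Set.mem_sdiff, Set.mem_singleton_iff,
        Set.mem_insert_iff]
      grind
    rw [this, Set.ncard_insert_of_notMem fun hy => hHxy hy.1]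
    exact Set.ncard_sdiff_singleton_add_one hux.symm
  have hKy : (K.neighborSet y).ncard = (H.neighborSet y).ncard := by
    have : K.neighborSet y = insert x (H.neighborSet y \ {u}) := by
      ext w; simp only [mem_neighborSet, hadj, Sym2.eq_iff, Set.mem_sdiff, Set.mem_singleton_iff,
        Set.mem_insert_iff]
      grind
    rw [this, Set.ncard_insert_of_notMem fun hx => hHxy hx.1.symm]
    exact Set.ncard_sdiff_singleton_add_one huy.symm
  have hKw : ∀ w, w ≠ u → (K.neighborSet w).ncard = (H.neighborSet w).ncard := by
    intro w hwu
    rcases eq_or_ne w x with rfl | hwx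
    · exact hKx
    rcases eq_or_ne w y with rfl | hwy
    · exact hKy
    congr 1
    ext z; simp only [mem_neighborSet, hadj, Sym2.eq_iff]
    grind
  refine h.not_ncard_lt hKG (fun w => ?_) (fun w => ?_) u (by omega)
  · rcases eq_or_ne w u with rfl | hwu
    · omega
    · exact hKw w hwu ▸ h.le_degree w
  · rcases eq_or_ne w u with rfl | hwu
    · omega
    · exact (hKw w hwu).le

/-- If every vertex of `G` is non-adjacent to at most `m` others, where `1 ≤ m`, then the degrees
in a minimum spanning subgraph exceed `k` by at most `m`. -/
theorem ncard_le {m : ℕ} (h : G.IsMinimumSpanning k H) (hm : 1 ≤ m)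
    (hG : ∀ v, Fintype.card V ≤ (G.neighborSet v).ncard + (m + 1)) (u : V) :
    (H.neighborSet u).ncard ≤ k + m := by
  by_contra! hu
  obtain ⟨x, hx⟩ : (H.neighborSet u).Nonempty := Set.nonempty_of_ncard_ne_zero (by omega)
  have hxk := h.ncard_eq_of_adj hx (by omega)
  have hcompl := Set.ncard_add_ncard_compl (G.neighborSet x)
  rw [Nat.card_eq_fintype_card] at hcompl
  have hsub : H.neighborSet u \ (G.neighborSet x)ᶜ ⊆ H.neighborSet x \ {u} := by
    rintro y ⟨hy, hxy⟩
    exact ⟨h.adj_of_adj hx hy (not_not.1 hxy) (by omega), (H.ne_of_adj hy).symm⟩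
  have h₁ := Set.ncard_le_ncard hsub
  have h₂ := Set.ncard_sdiff_singleton_add_one (s := H.neighborSet x) (a := u) hx.symm
  have h₃ := Set.le_ncard_sdiff (G.neighborSet x)ᶜ (H.neighborSet u)
  have := hG x
  omega

/-- The vertices of excess degree all lie outside the neighbourhood of any one of them. -/
theorem ncard_excess_add_ncard_le (h : G.IsMinimumSpanning k H)
    (hu : k < (H.neighborSet u).ncard) :
    {v | k < (H.neighborSet v).ncard}.ncard + (H.neighborSet u).ncard ≤ Fintype.card V := by
  rw [← Set.ncard_union_eq, ← Nat.card_eq_fintype_card]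
  · exact Set.ncard_le_card _
  · rw [Set.disjoint_right]
    intro v huv hv
    exact hv.ne' (h.ncard_eq_of_adj huv hu)

end IsMinimumSpanning

theorem sum_ncard_neighborSet_le {k j : ℕ} (h : ∀ v, (H.neighborSet v).ncard ≤ k + j) :
    ∑ v, (H.neighborSet v).ncard ≤
      Fintype.card V * k + {v | k < (H.neighborSet v).ncard}.ncard * j := by
  classical
  calc ∑ v, (H.neighborSet v).ncard
      ≤ ∑ v, (k + if k < (H.neighborSet v).ncard then j else 0) := by
        refine Finset.sum_le_sum fun v _ => ?_
        have := h v
        split_ifs <;> omega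
    _ = _ := by
        rw [Finset.sum_add_distrib, ← Finset.sum_filter, Set.ncard_eq_toFinset_card']
        simp

theorem sum_ncard_neighborSet (H : SimpleGraph V) :
    ∑ v, (H.neighborSet v).ncard = 2 * H.edgeSet.ncard := by
  classical
  have := H.sum_degrees_eq_twice_card_edges
  rw [← H.coe_edgeFinset, Set.ncard_coe_finset, ← this]
  exact Finset.sum_congr rfl fun v _ => H.ncard_neighborSet v

theorem IsMinimumSpanning.ncard_edgeSet_le (h : G.IsMinimumSpanning 4 H)
    (hG : ∀ v, Fintype.card V ≤ (G.neighborSet v).ncard + 3) (hV : 6 ≤ Fintype.card V) :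
    H.edgeSet.ncard ≤ 3 * Fintype.card V - 6 := by
  have hsum := H.sum_ncard_neighborSet
  have hdeg := h.ncard_le (by norm_num) hG
  by_cases h6 : ∃ u, 6 ≤ (H.neighborSet u).ncard
  · obtain ⟨u, hu⟩ := h6
    have := h.ncard_excess_add_ncard_le (u := u) (by omega)
    have := sum_ncard_neighborSet_le hdeg
    omega
  push Not at h6
  have hdeg₁ : ∀ v, (H.neighborSet v).ncard ≤ 4 + 1 := fun v => Nat.le_of_lt_succ (h6 v)
  by_cases h5 : ∃ u, 5 ≤ (H.neighborSet u).ncard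
  · obtain ⟨u, hu⟩ := h5
    have := h.ncard_excess_add_ncard_le (u := u) (by omega)
    have := sum_ncard_neighborSet_le hdeg₁
    omega
  push Not at h5
  have := sum_ncard_neighborSet_le (k := 4) (j := 0) fun v => Nat.le_of_lt_succ (h5 v)
  omega

end SimpleGraph

/-- If every vertex of `G` has degree at least `n - 3` (complement
has maximum degree ≤ 2), `|E| ≥ 3n - 6`, `n ≥ 6` and `δ(G) ≥ 4`, then `G` has a
spanning subgraph `H` with `δ(H) ≥ 4` and exactly `3n - 6` edges. -/
theorem stmt_13 {V : Type*} [Fintype V] [DecidableEq V] (G : SimpleGraph V)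
    [DecidableRel G.Adj] (n : ℕ) (hn : Fintype.card V = n) (hn6 : 6 ≤ n)
    (hcompl : ∀ v : V, n - 3 ≤ G.degree v)
    (hE : 3 * n - 6 ≤ G.edgeFinset.card)
    (hdel : ∀ v : V, 4 ≤ G.degree v) :
    ∃ H : SimpleGraph V, H ≤ G ∧ (∀ v : V, 4 ≤ (H.neighborSet v).ncard) ∧
      H.edgeSet.ncard = 3 * n - 6 := by
  subst hn
  have hdeg : ∀ v, (G.neighborSet v).ncard = G.degree v := fun v => G.ncard_neighborSet v
  obtain ⟨H, hH⟩ := SimpleGraph.exists_isMinimumSpanning (G := G) (k := 4)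
    fun v => hdeg v ▸ hdel v
  have hHE := hH.ncard_edgeSet_le
    (fun v => by have := hcompl v; have := hdeg v; omega) hn6
  rw [← Set.ncard_coe_finset, G.coe_edgeFinset] at hE
  obtain ⟨K, hHK, hKG, hK⟩ := SimpleGraph.exists_between_ncard_edgeSet_eq hH.le hHE hE
  exact ⟨K, hKG, fun v => (hH.le_degree v).trans (Set.ncard_le_ncard fun w hw => hHK hw), hK⟩
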